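/- Let Y be a symmetric positive definite g×g real matrix, ψ(x) = min_{m ∈ ℤ^g} ‖x - m‖_Y, λ₁(Y⁻¹) the first minimum of ℤ^g for ‖·‖_{Y⁻¹}, and λ = min(λ₁(Y⁻¹), √(π/(3g))). Then for every t ∈ (0, 2], ∫_{[0,1]^g} ln f_Y(2,x) dx ≤ -(g/2) ln t - π(2-t)/(12 λ₁(Y⁻¹)²), where f_Y(t,x) = √(det Y) Σ_{m ∈ ℤ^g} exp(-π t ‖x-m‖_Y²). -/

import Mathlib

open MeasureTheory Real Matrix

noncomputable def coeZ {g : ℕ} (m : Fin g → ℤ) : Fin g → ℝ := fun i => (m i : ℝ)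

noncomputable def normY {g : ℕ} (Y : Matrix (Fin g) (Fin g) ℝ) (x : Fin g → ℝ) : ℝ :=
  Real.sqrt (x ⬝ᵥ Y.mulVec x)

noncomputable def psi {g : ℕ} (Y : Matrix (Fin g) (Fin g) ℝ) (x : Fin g → ℝ) : ℝ :=
  ⨅ m : Fin g → ℤ, normY Y (x - coeZ m)

noncomputable def mu {g : ℕ} (Y : Matrix (Fin g) (Fin g) ℝ) : ℝ :=
  ⨆ x : Fin g → ℝ, psi Y x

noncomputable def lam1 {g : ℕ} (Y : Matrix (Fin g) (Fin g) ℝ) : ℝ :=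
  ⨅ m : {m : Fin g → ℤ // m ≠ 0}, normY Y (coeZ (m : Fin g → ℤ))

noncomputable def fY {g : ℕ} (Y : Matrix (Fin g) (Fin g) ℝ) (t : ℝ) (x : Fin g → ℝ) : ℝ :=
  Real.sqrt Y.det * ∑' m : Fin g → ℤ, Real.exp (-π * t * normY Y (x - coeZ m) ^ 2)

noncomputable def cube (g : ℕ) : Set (Fin g → ℝ) := Set.univ.pi fun _ => Set.Icc (0:ℝ) 1

lemma lintegral_cube_tsum_sub_coeZ {g : ℕ} {F : (Fin g → ℝ) → ENNReal} (hF : Measurable F) :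
    ∫⁻ x in cube g, ∑' m : Fin g → ℤ, F (x - coeZ m) = ∫⁻ x, F x := by
  set Q : Set (Fin g → ℝ) := Set.univ.pi fun _ => Set.Ico (0:ℝ) 1 with hQ
  have hQm : MeasurableSet Q := MeasurableSet.univ_pi fun _ => measurableSet_Ico
  have hcube : cube g =ᵐ[volume] Q :=
    (Measure.pi_Ico_ae_eq_pi_Icc (μ := fun _ : Fin g => (volume : Measure ℝ))
      (s := Set.univ) (f := fun _ => (0:ℝ)) (g := fun _ => (1:ℝ))).symm
  have hmem (x : Fin g → ℝ) (m : Fin g → ℤ) : x + coeZ m ∈ Q ↔ m = fun i => -⌊x i⌋ := by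
    simp only [hQ, Set.mem_univ_pi, Set.mem_Ico, Pi.add_apply, coeZ, funext_iff]
    refine forall_congr' fun i => ?_
    rw [eq_neg_iff_add_eq_zero, add_comm (m i), ← Int.floor_add_intCast, Int.floor_eq_zero_iff,
      Set.mem_Ico]
  have hmeas (m : Fin g → ℤ) : MeasurableSet ((fun x : Fin g → ℝ => x + coeZ m) ⁻¹' Q) :=
    hQm.preimage (measurable_add_const _)
  have hunion : ⋃ m : Fin g → ℤ, (fun x : Fin g → ℝ => x + coeZ m) ⁻¹' Q = Set.univ := by
    ext x
    simp [hmem]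
  have hdisj : Pairwise (Function.onFun Disjoint
      fun m : Fin g → ℤ => (fun x : Fin g → ℝ => x + coeZ m) ⁻¹' Q) := by
    intro m n hmn
    refine Set.disjoint_left.mpr fun x hx hx' => hmn ?_
    rw [Set.mem_preimage, hmem] at hx hx'
    rw [hx, hx']
  have hFm (m : Fin g → ℤ) : Measurable fun x => F (x - coeZ m) :=
    hF.comp (measurable_sub_const _)
  rw [setLIntegral_congr hcube, lintegral_tsum fun m => (hFm m).aemeasurable, ← setLIntegral_univ F, ← hunion,
    lintegral_iUnion hmeas hdisj]
  refine tsum_congr fun m => ?_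
  rw [← (measurePreserving_add_right volume (coeZ m)).setLIntegral_comp_preimage hQm (hFm m)]
  simp

lemma normY_sq {g : ℕ} {Y : Matrix (Fin g) (Fin g) ℝ} (hY : Y.PosSemidef) (x : Fin g → ℝ) :
    normY Y x ^ 2 = x ⬝ᵥ Y *ᵥ x :=
  Real.sq_sqrt (by simpa using hY.dotProduct_mulVec_nonneg x)

lemma measurable_normY {g : ℕ} (Y : Matrix (Fin g) (Fin g) ℝ) : Measurable (normY Y) := by
  have : Continuous (normY Y) := by
    unfold normY
    fun_prop
  exact this.measurable

lemma dotProduct_sq_le_normY_sq_mul {g : ℕ} {Y : Matrix (Fin g) (Fin g) ℝ} (hY : Y.PosDef)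
    (u v : Fin g → ℝ) : (u ⬝ᵥ v) ^ 2 ≤ normY Y⁻¹ u ^ 2 * normY Y v ^ 2 := by
  rcases eq_or_ne u 0 with rfl | hu
  · simp; positivity
  rw [normY_sq hY.inv.posSemidef, normY_sq hY.posSemidef]
  have hN : 0 < u ⬝ᵥ Y⁻¹ *ᵥ u := by simpa using hY.inv.dotProduct_mulVec_pos hu
  set N := u ⬝ᵥ Y⁻¹ *ᵥ u
  set s := u ⬝ᵥ v
  have hYz : Y *ᵥ (Y⁻¹ *ᵥ u) = u := by
    rw [mulVec_mulVec, mul_nonsing_inv _ ((isUnit_iff_isUnit_det _).mp hY.isUnit), one_mulVec]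
  have hzY : (Y⁻¹ *ᵥ u) ⬝ᵥ Y *ᵥ v = s := by
    have ht : Yᵀ = Y := by simpa using hY.isHermitian.eq
    rw [dotProduct_mulVec, ← mulVec_transpose, ht, hYz]
  have h := hY.posSemidef.dotProduct_mulVec_nonneg (N • v - s • Y⁻¹ *ᵥ u)
  simp only [star_trivial, mulVec_sub, mulVec_smul, dotProduct_sub, sub_dotProduct,
    smul_dotProduct, dotProduct_smul, smul_eq_mul, hYz, hzY] at h
  rw [dotProduct_comm v u, dotProduct_comm (Y⁻¹ *ᵥ u) u] at h
  change 0 ≤ N * (N * (v ⬝ᵥ Y *ᵥ v) - s * s) - s * (N * s - s * N) at h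
  have h' : 0 ≤ N * (v ⬝ᵥ Y *ᵥ v) - s * s := by
    rw [mul_comm s N, sub_self, mul_zero, sub_zero] at h
    exact nonneg_of_mul_nonneg_right h hN
  linarith [sq s]

lemma integral_sq_sub_round : ∫ u in (0:ℝ)..1, (u - round u) ^ 2 = 1 / 12 := by
  have hper : Function.Periodic (fun u : ℝ => (u - round u) ^ 2) 1 := fun u => by
    simp [round_add_one]
  have h := hper.intervalIntegral_add_eq 0 (-1 / 2)
  rw [zero_add] at h
  rw [h, intervalIntegral.integral_congr_uIoo (g := fun u : ℝ => u ^ 2) (fun u hu => ?_)]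
  · rw [integral_pow]
    norm_num
  · rw [Set.uIoo_of_lt (by norm_num)] at hu
    have : round u = 0 := by
      rw [round_eq, Int.floor_eq_zero_iff]
      constructor <;> linarith [hu.1, hu.2]
    simp [this]

lemma measurable_sq_sub_round : Measurable fun u : ℝ => (u - round u) ^ 2 := by
  simp only [round_eq]
  fun_prop

lemma norm_sq_sub_round_le (u : ℝ) : ‖(u - round u) ^ 2‖ ≤ 1 := by
  rw [norm_pow, Real.norm_eq_abs]
  exact pow_le_one₀ (abs_nonneg _) ((abs_sub_round u).trans (by norm_num))

lemma integral_sq_sub_round_comp_mul_add {k : ℤ} (hk : k ≠ 0) (c : ℝ) :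
    ∫ u in (0:ℝ)..1, (k * u + c - round (k * u + c)) ^ 2 = 1 / 12 := by
  have hper : Function.Periodic (fun u : ℝ => (u - round u) ^ 2) 1 := fun u => by
    simp [round_add_one]
  have hint (a b : ℝ) : IntervalIntegrable (fun u : ℝ => (u - round u) ^ 2) volume a b := by
    rw [intervalIntegrable_iff]
    exact Measure.integrableOn_of_bounded (M := 1) (by simp) measurable_sq_sub_round.aestronglyMeasurable
      (.of_forall norm_sq_sub_round_le)
  have hk' : (k : ℝ) ≠ 0 := by exact_mod_cast hk
  rw [intervalIntegral.integral_comp_mul_add (fun u : ℝ => (u - round u) ^ 2) hk' c]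
  have h := hper.intervalIntegral_add_zsmul_eq k c hint
  rw [hper.intervalIntegral_add_eq c 0, zero_add, integral_sq_sub_round] at h
  rw [mul_zero, zero_add, mul_one, add_comm, ← zsmul_one k, h]
  simp [hk']

lemma volume_cube (g : ℕ) : volume (cube g) = 1 := by
  rw [cube, volume_pi_pi]
  simp

lemma volume_cube_ne_top (g : ℕ) : volume (cube g) ≠ ⊤ := by
  simp [volume_cube]

lemma isCompact_cube (g : ℕ) : IsCompact (cube g) :=
  isCompact_univ_pi fun _ => isCompact_Icc

lemma integrableOn_sq_sub_round_dotProduct {g : ℕ} (u : Fin g → ℝ) :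
    IntegrableOn (fun x : Fin g → ℝ => (u ⬝ᵥ x - round (u ⬝ᵥ x)) ^ 2) (cube g) := by
  have hdot : Measurable fun x : Fin g → ℝ => u ⬝ᵥ x := by
    have : Continuous fun x : Fin g → ℝ => u ⬝ᵥ x := by fun_prop
    exact this.measurable
  exact Measure.integrableOn_of_bounded (M := 1) (volume_cube_ne_top g)
    (measurable_sq_sub_round.comp hdot).aestronglyMeasurable
    (.of_forall fun x => norm_sq_sub_round_le _)

lemma integral_cube_sq_sub_round_dotProduct {g : ℕ} {m : Fin g → ℤ} (hm : m ≠ 0) :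
    ∫ x in cube g, (coeZ m ⬝ᵥ x - round (coeZ m ⬝ᵥ x)) ^ 2 = 1 / 12 := by
  obtain ⟨i, hi⟩ := Function.ne_iff.mp hm
  obtain _ | n := g
  · exact i.elim0
  have hint := integrableOn_sq_sub_round_dotProduct (coeZ m)
  have hres : (volume : Measure (Fin (n + 1) → ℝ)).restrict (cube (n + 1)) =
      Measure.pi fun _ => volume.restrict (Set.Icc (0:ℝ) 1) :=
    Measure.restrict_pi_pi _ _
  rw [IntegrableOn, hres] at hint
  rw [hres]
  have hmp := (measurePreserving_piFinSuccAbove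
    (fun _ : Fin (n + 1) => volume.restrict (Set.Icc (0:ℝ) 1)) i).symm
  have : IsProbabilityMeasure (volume.restrict (Set.Icc (0:ℝ) 1)) := ⟨by simp⟩
  rw [← hmp.integral_comp']
  rw [← hmp.integrable_comp_emb (MeasurableEquiv.measurableEmbedding _)] at hint
  refine (integral_prod_symm _ hint).trans ?_
  have hinner (y : Fin n → ℝ) : ∫ u in Set.Icc (0:ℝ) 1,
      (coeZ m ⬝ᵥ i.insertNth u y - round (coeZ m ⬝ᵥ i.insertNth (α := fun _ => ℝ) u y)) ^ 2 =
        1 / 12 := by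
    rw [integral_Icc_eq_integral_Ioc, ← intervalIntegral.integral_of_le zero_le_one,
      ← integral_sq_sub_round_comp_mul_add hi (∑ j, coeZ m (i.succAbove j) * y j)]
    simp [dotProduct, Fin.sum_univ_succAbove _ i, coeZ]
  refine (integral_congr_ae (.of_forall hinner)).trans ?_
  simp

lemma lintegral_exp_neg_normY_sq {g : ℕ} {Y : Matrix (Fin g) (Fin g) ℝ} (hY : Y.PosDef) {t : ℝ}
    (ht : 0 < t) :
    ∫⁻ x, ENNReal.ofReal (Real.exp (-π * t * normY Y x ^ 2)) =
      ENNReal.ofReal ((√Y.det)⁻¹ * √(1 / t) ^ g) := by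
  obtain ⟨B, hB⟩ : ∃ B : Matrix (Fin g) (Fin g) ℝ, Y = Bᵀ * B := by
    open scoped MatrixOrder Matrix.Norms.L2Operator in
    obtain ⟨B, hB⟩ := CStarAlgebra.nonneg_iff_eq_star_mul_self.mp hY.posSemidef.nonneg
    exact ⟨B, by simpa [star_eq_conjTranspose] using hB⟩
  have hdet : Y.det = B.det ^ 2 := by rw [hB, det_mul, det_transpose, sq]
  have hB0 : B.det ≠ 0 := by
    intro h
    have := hY.det_pos
    simp [hdet, h] at this
  have hnorm (x : Fin g → ℝ) :
      Real.exp (-π * t * normY Y x ^ 2) = ∏ i, Real.exp (-(π * t) * (B *ᵥ x) i ^ 2) := by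
    rw [normY_sq hY.posSemidef, ← Real.exp_sum, ← Finset.mul_sum, hB, ← mulVec_mulVec,
      dotProduct_mulVec, vecMul_transpose, neg_mul]
    simp [dotProduct, sq]
  have hexp : Integrable fun x : ℝ => Real.exp (-(π * t) * x ^ 2) :=
    integrable_exp_neg_mul_sq (by positivity)
  have hG : Integrable fun y : Fin g → ℝ => ∏ i, Real.exp (-(π * t) * y i ^ 2) :=
    Integrable.fintype_prod (f := fun _ (x : ℝ) => Real.exp (-(π * t) * x ^ 2)) fun _ => hexp
  have hGm : Measurable fun y : Fin g → ℝ =>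
      ENNReal.ofReal (∏ i, Real.exp (-(π * t) * y i ^ 2)) := by fun_prop
  have hmap := Real.map_matrix_volume_pi_eq_smul_volume_pi hB0
  have hlin : Measurable (toLin' B) := (LinearMap.continuous_of_finiteDimensional _).measurable
  calc ∫⁻ x, ENNReal.ofReal (Real.exp (-π * t * normY Y x ^ 2))
      = ∫⁻ y, ENNReal.ofReal (∏ i, Real.exp (-(π * t) * y i ^ 2))
          ∂(Measure.map (toLin' B) volume) := by
        rw [lintegral_map hGm hlin]
        simp only [hnorm, toLin'_apply]
    _ = ENNReal.ofReal ((√Y.det)⁻¹ * √(1 / t) ^ g) := by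
        rw [hmap, lintegral_smul_measure, ← ofReal_integral_eq_lintegral_ofReal hG
          (.of_forall fun y => Finset.prod_nonneg fun i _ => (Real.exp_pos _).le),
          integral_fintype_prod_volume_eq_prod (fun _ (x : ℝ) => Real.exp (-(π * t) * x ^ 2)),
          smul_eq_mul, ← ENNReal.ofReal_mul (abs_nonneg _), hdet, Real.sqrt_sq_eq_abs, abs_inv]
        simp only [integral_gaussian, Finset.prod_const, Finset.card_univ, Fintype.card_fin]
        rw [← div_div, div_self Real.pi_ne_zero]

lemma fY_eq_toReal {g : ℕ} (Y : Matrix (Fin g) (Fin g) ℝ) (t : ℝ) (x : Fin g → ℝ) :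
    fY Y t x = √Y.det *
      (∑' m : Fin g → ℤ, ENNReal.ofReal (Real.exp (-π * t * normY Y (x - coeZ m) ^ 2))).toReal := by
  rw [ENNReal.tsum_toReal_eq fun _ => ENNReal.ofReal_ne_top, fY]
  simp only [ENNReal.toReal_ofReal (Real.exp_pos _).le]

lemma measurable_tsum_exp_neg_normY_sq {g : ℕ} (Y : Matrix (Fin g) (Fin g) ℝ) (t : ℝ) :
    Measurable fun x : Fin g → ℝ => ∑' m : Fin g → ℤ,
      ENNReal.ofReal (Real.exp (-π * t * normY Y (x - coeZ m) ^ 2)) := by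
  have := measurable_normY Y
  fun_prop

lemma lintegral_cube_tsum_exp_neg_normY_sq {g : ℕ} {Y : Matrix (Fin g) (Fin g) ℝ} (hY : Y.PosDef)
    {t : ℝ} (ht : 0 < t) :
    ∫⁻ x in cube g, ∑' m : Fin g → ℤ,
      ENNReal.ofReal (Real.exp (-π * t * normY Y (x - coeZ m) ^ 2)) =
      ENNReal.ofReal ((√Y.det)⁻¹ * √(1 / t) ^ g) := by
  have := measurable_normY Y
  rw [← lintegral_exp_neg_normY_sq hY ht, ← lintegral_cube_tsum_sub_coeZ
    (F := fun x => ENNReal.ofReal (Real.exp (-π * t * normY Y x ^ 2))) (by fun_prop)]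

lemma integrableOn_fY {g : ℕ} {Y : Matrix (Fin g) (Fin g) ℝ} (hY : Y.PosDef) {t : ℝ}
    (ht : 0 < t) : IntegrableOn (fY Y t) (cube g) := by
  simp only [funext (fY_eq_toReal Y t)]
  refine Integrable.const_mul (integrable_toReal_of_lintegral_ne_top
    (measurable_tsum_exp_neg_normY_sq Y t).aemeasurable ?_) _
  rw [lintegral_cube_tsum_exp_neg_normY_sq hY ht]
  exact ENNReal.ofReal_ne_top

lemma ae_tsum_exp_neg_normY_sq_lt_top {g : ℕ} {Y : Matrix (Fin g) (Fin g) ℝ} (hY : Y.PosDef)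
    {t : ℝ} (ht : 0 < t) :
    ∀ᵐ x ∂volume.restrict (cube g), ∑' m : Fin g → ℤ,
      ENNReal.ofReal (Real.exp (-π * t * normY Y (x - coeZ m) ^ 2)) < ⊤ := by
  refine ae_lt_top (measurable_tsum_exp_neg_normY_sq Y t) ?_
  rw [lintegral_cube_tsum_exp_neg_normY_sq hY ht]
  exact ENNReal.ofReal_ne_top

lemma integral_cube_fY {g : ℕ} {Y : Matrix (Fin g) (Fin g) ℝ} (hY : Y.PosDef) {t : ℝ}
    (ht : 0 < t) : ∫ x in cube g, fY Y t x = √(1 / t) ^ g := by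
  simp only [fY_eq_toReal Y t]
  rw [integral_const_mul, integral_toReal (measurable_tsum_exp_neg_normY_sq Y t).aemeasurable
    (ae_tsum_exp_neg_normY_sq_lt_top hY ht), lintegral_cube_tsum_exp_neg_normY_sq hY ht,
    ENNReal.toReal_ofReal (by positivity), mul_inv_cancel_left₀]
  exact (Real.sqrt_pos.mpr hY.det_pos).ne'

lemma ae_summable_exp_neg_normY_sq {g : ℕ} {Y : Matrix (Fin g) (Fin g) ℝ} (hY : Y.PosDef)
    {t : ℝ} (ht : 0 < t) :
    ∀ᵐ x ∂volume.restrict (cube g), Summable fun m : Fin g → ℤ =>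
      Real.exp (-π * t * normY Y (x - coeZ m) ^ 2) := by
  filter_upwards [ae_tsum_exp_neg_normY_sq_lt_top hY ht] with x hx
  simpa only [ENNReal.toReal_ofReal (Real.exp_pos _).le] using ENNReal.summable_toReal hx.ne

lemma fY_pos {g : ℕ} {Y : Matrix (Fin g) (Fin g) ℝ} (hY : Y.PosDef) {t : ℝ} {x : Fin g → ℝ}
    (hs : Summable fun m : Fin g → ℤ => Real.exp (-π * t * normY Y (x - coeZ m) ^ 2)) :
    0 < fY Y t x :=
  mul_pos (Real.sqrt_pos.mpr hY.det_pos)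
    (hs.tsum_pos (fun _ => (Real.exp_pos _).le) 0 (Real.exp_pos _))

lemma fY_le_mul_exp {g : ℕ} {Y : Matrix (Fin g) (Fin g) ℝ} {s t : ℝ} (hst : t ≤ s)
    {x : Fin g → ℝ} {r : ℝ} (hr : ∀ m : Fin g → ℤ, r ≤ normY Y (x - coeZ m) ^ 2)
    (hs : Summable fun m : Fin g → ℤ => Real.exp (-π * s * normY Y (x - coeZ m) ^ 2))
    (ht : Summable fun m : Fin g → ℤ => Real.exp (-π * t * normY Y (x - coeZ m) ^ 2)) :
    fY Y s x ≤ fY Y t x * Real.exp (-(π * (s - t) * r)) := by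
  rw [fY, fY, mul_assoc, ← tsum_mul_right]
  refine mul_le_mul_of_nonneg_left (hs.tsum_le_tsum (fun m => ?_) (ht.mul_right _))
    (Real.sqrt_nonneg _)
  rw [← Real.exp_add, Real.exp_le_exp]
  have := mul_le_mul_of_nonneg_left (hr m) (mul_nonneg Real.pi_pos.le (sub_nonneg.mpr hst))
  linarith

lemma sq_sub_round_div_le_normY_sq {g : ℕ} {Y : Matrix (Fin g) (Fin g) ℝ} (hY : Y.PosDef)
    (m n : Fin g → ℤ) (x : Fin g → ℝ) :
    (coeZ m ⬝ᵥ x - round (coeZ m ⬝ᵥ x)) ^ 2 / normY Y⁻¹ (coeZ m) ^ 2 ≤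
      normY Y (x - coeZ n) ^ 2 := by
  refine div_le_of_le_mul₀ (sq_nonneg _) (sq_nonneg _) ?_
  rw [mul_comm]
  refine le_trans ?_ (dotProduct_sq_le_normY_sq_mul hY (coeZ m) (x - coeZ n))
  have hint : coeZ m ⬝ᵥ coeZ n = ((m ⬝ᵥ n : ℤ) : ℝ) := by simp [dotProduct, coeZ]
  rw [dotProduct_sub, hint, sq_le_sq]
  exact round_le _ _

lemma integrableOn_log_fY {g : ℕ} {Y : Matrix (Fin g) (Fin g) ℝ} (hY : Y.PosDef) {t : ℝ}
    (ht : 0 < t) : IntegrableOn (fun x => Real.log (fY Y t x)) (cube g) := by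
  have hcont : Continuous fun x : Fin g → ℝ =>
      Real.log √Y.det + -π * t * normY Y (x - coeZ 0) ^ 2 := by
    unfold normY
    fun_prop
  have hmeas : Measurable (fY Y t) := by
    simp only [funext (fY_eq_toReal Y t)]
    exact (measurable_tsum_exp_neg_normY_sq Y t).ennreal_toReal.const_mul _
  refine integrable_of_le_of_le hmeas.log.aestronglyMeasurable ?_ ?_
    (hcont.continuousOn.integrableOn_compact (isCompact_cube g)) (integrableOn_fY hY ht)
  · filter_upwards [ae_summable_exp_neg_normY_sq hY ht] with x hx
    have hd := Real.sqrt_pos.mpr hY.det_pos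
    rw [Real.le_log_iff_exp_le (fY_pos hY hx), Real.exp_add, Real.exp_log hd]
    exact mul_le_mul_of_nonneg_left (hx.le_tsum 0 fun _ _ => (Real.exp_pos _).le) hd.le
  · filter_upwards [ae_summable_exp_neg_normY_sq hY ht] with x hx
    linarith [Real.log_le_sub_one_of_pos (fY_pos hY hx)]

lemma integral_log_fY_two_le_of_ne_zero {g : ℕ} {Y : Matrix (Fin g) (Fin g) ℝ} (hY : Y.PosDef)
    {t : ℝ} (ht : t ∈ Set.Ioc (0:ℝ) 2) {m : Fin g → ℤ} (hm : m ≠ 0) :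
    ∫ x in cube g, Real.log (fY Y 2 x) ≤
      -(g / 2 : ℝ) * Real.log t - π * (2 - t) / (12 * normY Y⁻¹ (coeZ m) ^ 2) := by
  set c : ℝ := √(1 / t) ^ g with hc
  have ht0 := ht.1
  have hcpos : 0 < c := by positivity
  have hlogc : Real.log c = -(g / 2 : ℝ) * Real.log t := by
    rw [hc, Real.log_pow, Real.log_sqrt (by positivity), one_div, Real.log_inv]
    ring
  set N := normY Y⁻¹ (coeZ m) ^ 2
  set d : (Fin g → ℝ) → ℝ := fun x => (coeZ m ⬝ᵥ x - round (coeZ m ⬝ᵥ x)) ^ 2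
  have hdint : IntegrableOn d (cube g) := integrableOn_sq_sub_round_dotProduct _
  have hdval : ∫ x in cube g, d x = 1 / 12 := integral_cube_sq_sub_round_dotProduct hm
  have hf := integrableOn_fY hY ht0
  have hconst : IntegrableOn (fun _ : Fin g → ℝ => Real.log c - 1) (cube g) :=
    integrableOn_const (volume_cube_ne_top g)
  have hle : ∀ᵐ x ∂volume.restrict (cube g), Real.log (fY Y 2 x) ≤
      (c⁻¹ * fY Y t x + (Real.log c - 1)) - π * (2 - t) / N * d x := by
    filter_upwards [ae_summable_exp_neg_normY_sq hY ht0,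
      ae_summable_exp_neg_normY_sq hY zero_lt_two] with x hxt hx2
    have hft := fY_pos hY hxt
    have h := Real.log_le_log (fY_pos hY hx2)
      (fY_le_mul_exp ht.2 (fun n => sq_sub_round_div_le_normY_sq hY m n x) hx2 hxt)
    rw [Real.log_mul hft.ne' (Real.exp_pos _).ne', Real.log_exp] at h
    have h1 := Real.log_le_sub_one_of_pos (mul_pos (inv_pos.mpr hcpos) hft)
    rw [Real.log_mul (inv_pos.mpr hcpos).ne' hft.ne', Real.log_inv] at h1
    have h2 : π * (2 - t) / N * d x = π * (2 - t) * (d x / N) := by ring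
    rw [h2]
    linarith
  refine (integral_mono_ae (integrableOn_log_fY hY zero_lt_two)
    (((hf.const_mul _).add hconst).sub (hdint.const_mul _)) hle).trans_eq ?_
  have hvol : volume.real (cube g) = 1 := by simp [Measure.real, volume_cube]
  rw [integral_sub' ((hf.const_mul _).add hconst) (hdint.const_mul _),
    integral_add' (hf.const_mul _) hconst, integral_const_mul, integral_const_mul,
    integral_cube_fY hY ht0, hdval, setIntegral_const, hvol, inv_mul_cancel₀ hcpos.ne', ← hlogc,
    one_smul]
  ring

theorem integral_log_fY_two_le_aux {g : ℕ} (hg : 1 ≤ g) (Y : Matrix (Fin g) (Fin g) ℝ)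
    (hsymm : Y.IsSymm) (hY : Y.PosDef) (t : ℝ) (ht : t ∈ Set.Ioc (0:ℝ) 2) :
    ∫ x in cube g, Real.log (fY Y 2 x) ≤
      -(g / 2 : ℝ) * Real.log t - π * (2 - t) / (12 * lam1 Y⁻¹ ^ 2) := by
  set A := π * (2 - t)
  set K := -(g / 2 : ℝ) * Real.log t - ∫ x in cube g, Real.log (fY Y 2 x) with hKdef
  have hA : 0 ≤ A := mul_nonneg Real.pi_pos.le (sub_nonneg.mpr ht.2)
  suffices h : A / (12 * lam1 Y⁻¹ ^ 2) ≤ K by linarith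
  have hK (m : Fin g → ℤ) (hm : m ≠ 0) : A / (12 * normY Y⁻¹ (coeZ m) ^ 2) ≤ K := by
    linarith [integral_log_fY_two_le_of_ne_zero hY ht hm]
  have hnorm (m : Fin g → ℤ) (hm : m ≠ 0) : 0 < normY Y⁻¹ (coeZ m) := by
    have hm' : coeZ m ≠ 0 := fun h => hm <| funext fun i => by
      simpa [coeZ] using congrFun h i
    exact Real.sqrt_pos.mpr (by simpa using hY.inv.dotProduct_mulVec_pos hm')
  have hne : (fun _ : Fin g => (1 : ℤ)) ≠ 0 := fun h => one_ne_zero (congrFun h ⟨0, hg⟩)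
  have : Nonempty {m : Fin g → ℤ // m ≠ 0} := ⟨⟨_, hne⟩⟩
  have hK0 : 0 ≤ K := le_trans (by positivity) (hK _ hne)
  rcases hA.eq_or_lt with hA0 | hApos
  · rw [← hA0, zero_div]
    exact hK0
  have hKpos : 0 < K := by
    refine lt_of_lt_of_le ?_ (hK _ hne)
    have := hnorm _ hne
    positivity
  have hlam : √(A / (12 * K)) ≤ lam1 Y⁻¹ := by
    refine le_ciInf fun m => Real.sqrt_le_iff.mpr ⟨(hnorm m m.2).le, ?_⟩
    have hm := hnorm m m.2
    have h := hK m m.2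
    rw [div_le_iff₀ (by positivity)] at h ⊢
    linarith
  have hlam0 : 0 < lam1 Y⁻¹ := lt_of_lt_of_le (by positivity) hlam
  have h := (Real.sqrt_le_left hlam0.le).mp hlam
  rw [div_le_iff₀ (by positivity)] at h ⊢
  linarith
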